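/- Let Φ : ℝ × ℝ → ℝ be a smooth function of (x,t) solving the Monge-Ampere equation Φ_tt = Φ_xt²/Φ_xx + (1/2)·Φ_x², with Φ_xx nowhere zero. Set u = Φ_xt/(2Φ_xx) and v = −Φ_x/4, so that v_x = −Φ_xx/4, and define α₁ = u_x²·v_x^{−2} − 2·v_x^{−1}, β₁ = u_x·v_x^{−1}, and recursively α_{k+1} = v_x^{−1}·∂_x α_k, β_{k+1} = v_x^{−1}·∂_x β_k for k ≥ 1. Then for any n ≥ 1 and any smooth function G : ℝ^{2n−1} → ℝ, the function F = (v_x/2)·G(α₁, α₂, β₂, …, α_n, β_n) satisfies the conservation law ∂_t F = ∂_x(2u·F) at every point. -/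

import Mathlib

/-- Partial derivative with respect to the first variable `x`. -/
noncomputable def pdx (f : ℝ × ℝ → ℝ) (p : ℝ × ℝ) : ℝ := deriv (fun x => f (x, p.2)) p.1

/-- Partial derivative with respect to the second variable `t`. -/
noncomputable def pdt (f : ℝ × ℝ → ℝ) (p : ℝ × ℝ) : ℝ := deriv (fun t => f (p.1, t)) p.2

open scoped ContDiff

theorem pdx_eq_fderiv {f : ℝ × ℝ → ℝ} (hf : ContDiff ℝ ∞ f) (p : ℝ × ℝ) :
    pdx f p = fderiv ℝ f p (1, 0) := by
  have h := (hf.differentiable (by simp) p).hasFDerivAt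
  have hc : HasDerivAt (fun x : ℝ => (x, p.2)) ((1 : ℝ), (0 : ℝ)) p.1 :=
    (hasDerivAt_id p.1).prodMk (hasDerivAt_const p.1 p.2)
  exact (HasFDerivAt.comp_hasDerivAt (f := fun x : ℝ => (x, p.2)) p.1 h hc).deriv

theorem pdt_eq_fderiv {f : ℝ × ℝ → ℝ} (hf : ContDiff ℝ ∞ f) (p : ℝ × ℝ) :
    pdt f p = fderiv ℝ f p (0, 1) := by
  have h := (hf.differentiable (by simp) p).hasFDerivAt
  have hc : HasDerivAt (fun t : ℝ => (p.1, t)) ((0 : ℝ), (1 : ℝ)) p.2 :=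
    (hasDerivAt_const p.2 p.1).prodMk (hasDerivAt_id p.2)
  exact (HasFDerivAt.comp_hasDerivAt (f := fun t : ℝ => (p.1, t)) p.2 h hc).deriv

theorem contDiff_fderiv_const {f : ℝ × ℝ → ℝ} (hf : ContDiff ℝ ∞ f) (d : ℝ × ℝ) :
    ContDiff ℝ ∞ (fun p => fderiv ℝ f p d) :=
  (hf.fderiv_right (by simp)).clm_apply contDiff_const

theorem contDiff_pdx {f : ℝ × ℝ → ℝ} (hf : ContDiff ℝ ∞ f) : ContDiff ℝ ∞ (pdx f) := by
  rw [funext (pdx_eq_fderiv hf)]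
  exact contDiff_fderiv_const hf _

theorem contDiff_pdt {f : ℝ × ℝ → ℝ} (hf : ContDiff ℝ ∞ f) : ContDiff ℝ ∞ (pdt f) := by
  rw [funext (pdt_eq_fderiv hf)]
  exact contDiff_fderiv_const hf _

theorem fderiv_fderiv_const {f : ℝ × ℝ → ℝ} (hf : ContDiff ℝ ∞ f) (d e p : ℝ × ℝ) :
    fderiv ℝ (fun q => fderiv ℝ f q d) p e = fderiv ℝ (fderiv ℝ f) p e d := by
  have h : DifferentiableAt ℝ (fderiv ℝ f) p :=
    (hf.fderiv_right (m := ∞) (by simp)).differentiable (by simp) p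
  rw [fderiv_clm_apply h (differentiableAt_const d)]
  simp

theorem pdt_pdx_comm {f : ℝ × ℝ → ℝ} (hf : ContDiff ℝ ∞ f) (p : ℝ × ℝ) :
    pdt (pdx f) p = pdx (pdt f) p := by
  rw [pdt_eq_fderiv (contDiff_pdx hf), pdx_eq_fderiv (contDiff_pdt hf),
    funext (pdx_eq_fderiv hf), funext (pdt_eq_fderiv hf),
    fderiv_fderiv_const hf, fderiv_fderiv_const hf]
  exact (hf.contDiffAt.isSymmSndFDerivAt (by simpa using WithTop.coe_le_coe.2 (le_top : (2 : ℕ∞) ≤ ⊤))) _ _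

theorem pdx_mul {f g : ℝ × ℝ → ℝ} (hf : ContDiff ℝ ∞ f) (hg : ContDiff ℝ ∞ g) (p : ℝ × ℝ) :
    pdx (fun q => f q * g q) p = pdx f p * g p + f p * pdx g p := by
  rw [pdx_eq_fderiv (hf.mul hg), pdx_eq_fderiv hf, pdx_eq_fderiv hg,
    fderiv_fun_mul (hf.differentiable (by simp) p) (hg.differentiable (by simp) p)]
  simp
  ring

theorem pdt_mul {f g : ℝ × ℝ → ℝ} (hf : ContDiff ℝ ∞ f) (hg : ContDiff ℝ ∞ g) (p : ℝ × ℝ) :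
    pdt (fun q => f q * g q) p = pdt f p * g p + f p * pdt g p := by
  rw [pdt_eq_fderiv (hf.mul hg), pdt_eq_fderiv hf, pdt_eq_fderiv hg,
    fderiv_fun_mul (hf.differentiable (by simp) p) (hg.differentiable (by simp) p)]
  simp
  ring

theorem pdx_add {f g : ℝ × ℝ → ℝ} (hf : ContDiff ℝ ∞ f) (hg : ContDiff ℝ ∞ g) (p : ℝ × ℝ) :
    pdx (fun q => f q + g q) p = pdx f p + pdx g p := by
  rw [pdx_eq_fderiv (hf.add hg), pdx_eq_fderiv hf, pdx_eq_fderiv hg,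
    fderiv_fun_add (hf.differentiable (by simp) p) (hg.differentiable (by simp) p)]
  simp

theorem pdt_add {f g : ℝ × ℝ → ℝ} (hf : ContDiff ℝ ∞ f) (hg : ContDiff ℝ ∞ g) (p : ℝ × ℝ) :
    pdt (fun q => f q + g q) p = pdt f p + pdt g p := by
  rw [pdt_eq_fderiv (hf.add hg), pdt_eq_fderiv hf, pdt_eq_fderiv hg,
    fderiv_fun_add (hf.differentiable (by simp) p) (hg.differentiable (by simp) p)]
  simp

theorem pdx_const (c : ℝ) (p : ℝ × ℝ) : pdx (fun _ => c) p = 0 := by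
  simp [pdx]

theorem pdt_const (c : ℝ) (p : ℝ × ℝ) : pdt (fun _ => c) p = 0 := by
  simp [pdt]

/-- The derivative of `f` along the vector field `∂_t - 2u ∂_x`. -/
noncomputable def transport (u f : ℝ × ℝ → ℝ) (p : ℝ × ℝ) : ℝ := pdt f p - 2 * u p * pdx f p

theorem transport_eq_fderiv (u : ℝ × ℝ → ℝ) {f : ℝ × ℝ → ℝ} (hf : ContDiff ℝ ∞ f)
    (p : ℝ × ℝ) : transport u f p = fderiv ℝ f p (-2 * u p, 1) := by
  have h : ((-2 * u p, 1) : ℝ × ℝ) = (0, 1) + (-2 * u p) • ((1, 0) : ℝ × ℝ) := by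
    ext <;> simp
  rw [h, map_add, map_smul, transport, pdx_eq_fderiv hf, pdt_eq_fderiv hf, smul_eq_mul]
  ring

theorem transport_mul (u : ℝ × ℝ → ℝ) {f g : ℝ × ℝ → ℝ} (hf : ContDiff ℝ ∞ f)
    (hg : ContDiff ℝ ∞ g) (p : ℝ × ℝ) :
    transport u (fun q => f q * g q) p = transport u f p * g p + f p * transport u g p := by
  simp only [transport, pdx_mul hf hg, pdt_mul hf hg]
  ring

theorem transport_add (u : ℝ × ℝ → ℝ) {f g : ℝ × ℝ → ℝ} (hf : ContDiff ℝ ∞ f)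
    (hg : ContDiff ℝ ∞ g) (p : ℝ × ℝ) :
    transport u (fun q => f q + g q) p = transport u f p + transport u g p := by
  simp only [transport, pdx_add hf hg, pdt_add hf hg]
  ring

theorem transport_const (u : ℝ × ℝ → ℝ) (c : ℝ) (p : ℝ × ℝ) :
    transport u (fun _ => c) p = 0 := by
  simp [transport, pdx_const, pdt_const]

theorem pdx_transport {u f : ℝ × ℝ → ℝ} (hu : ContDiff ℝ ∞ u) (hf : ContDiff ℝ ∞ f)
    (p : ℝ × ℝ) :
    pdx (transport u f) p = transport u (pdx f) p - 2 * pdx u p * pdx f p := by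
  have e : transport u f = fun q => pdt f q + (-2) * (u q * pdx f q) := by
    funext q
    simp only [transport]
    ring
  have h := hu.mul (contDiff_pdx hf)
  rw [e, pdx_add (contDiff_pdt hf) (contDiff_const.mul h), pdx_mul contDiff_const h,
    pdx_mul hu (contDiff_pdx hf), pdx_const, transport, pdt_pdx_comm hf]
  ring

theorem transport_div_pdx {u v f g : ℝ × ℝ → ℝ} (hu : ContDiff ℝ ∞ u) (hv : ContDiff ℝ ∞ v)
    (hv0 : ∀ p, pdx v p ≠ 0) (htv : ∀ p, transport u v p = 0)
    (hf : ContDiff ℝ ∞ f) (hg : ∀ p, g p = (pdx v p)⁻¹ * pdx f p) (c : ℝ)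
    (htf : ∀ p, transport u f p = c) :
    ContDiff ℝ ∞ g ∧ ∀ p, transport u g p = 0 := by
  have hgs : ContDiff ℝ ∞ g := by
    rw [funext hg]
    exact ((contDiff_pdx hv).inv hv0).mul (contDiff_pdx hf)
  refine ⟨hgs, fun p => ?_⟩
  have e : (fun q => g q * pdx v q) = pdx f := by
    funext q
    rw [hg]
    field_simp [hv0 q]
  have h1 := transport_mul u hgs (contDiff_pdx hv) p
  have h2 := pdx_transport hu hf p
  have h3 := pdx_transport hu hv p
  rw [funext htf, pdx_const] at h2
  rw [funext htv, pdx_const] at h3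
  rw [e] at h1
  have e' := congrFun e p
  apply (mul_eq_zero.mp (_ : transport u g p * pdx v p = 0)).resolve_right (hv0 p)
  linear_combination -h1 - h2 + g p * h3 - 2 * pdx u p * e'

theorem transport_comp_eq_zero (u : ℝ × ℝ → ℝ) {ι : Type*} [Fintype ι] {G : (ι → ℝ) → ℝ}
    (hG : ContDiff ℝ ∞ G) {A : ℝ × ℝ → ι → ℝ} (hA : ∀ i, ContDiff ℝ ∞ fun q => A q i)
    (htA : ∀ i p, transport u (fun q => A q i) p = 0) (p : ℝ × ℝ) :
    transport u (fun q => G (A q)) p = 0 := by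
  have hAs : ContDiff ℝ ∞ A := contDiff_pi.2 hA
  rw [transport_eq_fderiv u (f := fun q => G (A q)) (hG.comp hAs),
    fderiv_fun_comp p (hG.differentiable (by simp) _) (hAs.differentiable (by simp) p)]
  have h0 : fderiv ℝ A p (-2 * u p, 1) = 0 := by
    funext i
    have h := htA i p
    rw [transport_eq_fderiv u (hA i)] at h
    rw [fderiv_pi (fun i => (hA i).differentiable (by simp) p)]
    exact h
  rw [ContinuousLinearMap.comp_apply, h0, map_zero]

/-- Smooth solutions of the Monge-Ampere equation give solutions of the system
`v_t = 2u v_x`, `u_t = 2u u_x - 2v`. -/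
theorem gurevichZybin_of_mongeAmpere {Φ u v : ℝ × ℝ → ℝ} (hΦ : ContDiff ℝ ∞ Φ)
    (heq : ∀ p : ℝ × ℝ,
      pdt (pdt Φ) p = (pdt (pdx Φ) p) ^ 2 / pdx (pdx Φ) p + 1 / 2 * (pdx Φ p) ^ 2)
    (hΦxx : ∀ p : ℝ × ℝ, pdx (pdx Φ) p ≠ 0)
    (hud : ∀ p : ℝ × ℝ, u p = pdt (pdx Φ) p / (2 * pdx (pdx Φ) p))
    (hvd : ∀ p : ℝ × ℝ, v p = -(pdx Φ p) / 4) :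
    ContDiff ℝ ∞ u ∧ ContDiff ℝ ∞ v ∧ (∀ p, pdx v p ≠ 0) ∧ (∀ p, transport u v p = 0) ∧
      ∀ p, transport u u p = -2 * v p := by
  have hX := contDiff_pdx hΦ
  have hXX := contDiff_pdx hX
  have hT := contDiff_pdt hΦ
  have hus : ContDiff ℝ ∞ u := by
    rw [funext hud]
    exact (contDiff_pdt hX).div (contDiff_const.mul hXX) fun p => by simp [hΦxx p]
  have hv' : v = fun q => (-1 / 4) * pdx Φ q := by
    funext q
    rw [hvd]
    ring
  have hvs : ContDiff ℝ ∞ v := by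
    rw [hv']
    exact contDiff_const.mul hX
  have hvx : ∀ p, pdx v p = (-1 / 4) * pdx (pdx Φ) p := fun p => by
    rw [hv', pdx_mul contDiff_const hX, pdx_const]
    ring
  have hvt : ∀ p, pdt v p = (-1 / 4) * pdt (pdx Φ) p := fun p => by
    rw [hv', pdt_mul contDiff_const hX, pdt_const]
    ring
  have hXt : ∀ p, pdt (pdx Φ) p = 2 * (u p * pdx (pdx Φ) p) := fun p => by
    rw [hud]
    field_simp [hΦxx p]
  refine ⟨hus, hvs, fun p => ?_, fun p => ?_, fun p => ?_⟩
  · rw [hvx]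
    simp [hΦxx p]
  · rw [transport, hvt, hvx, hXt]
    ring
  have huX := hus.mul hXX
  have huuX := hus.mul huX
  have htt : pdt (pdt Φ) =
      fun q => 4 * (u q * (u q * pdx (pdx Φ) q)) + 1 / 2 * (pdx Φ q * pdx Φ q) := by
    funext q
    rw [heq, hXt]
    field_simp [hΦxx q]
    ring
  have h1 : pdx (pdt (pdt Φ)) p = pdt (pdt (pdx Φ)) p := by
    rw [← pdt_pdx_comm hT, ← funext (pdt_pdx_comm hΦ)]
  have h2 : pdt (pdx (pdx Φ)) p = pdx (pdt (pdx Φ)) p := pdt_pdx_comm hX p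
  rw [htt, funext hXt, pdx_add (contDiff_const.mul huuX) (contDiff_const.mul (hX.mul hX)),
    pdx_mul contDiff_const huuX, pdx_mul contDiff_const (hX.mul hX), pdx_mul hus huX,
    pdx_mul hus hXX, pdx_mul hX hX, pdt_mul contDiff_const huX, pdt_mul hus hXX,
    pdx_const, pdx_const, pdt_const, h2, funext hXt, pdx_mul contDiff_const huX,
    pdx_mul hus hXX, pdx_const] at h1
  apply mul_right_cancel₀ (hΦxx p)
  rw [transport, hvd]
  linear_combination (-1 / 2) * h1


theorem mongeAmpere_conserved_density (Φ u v : ℝ × ℝ → ℝ)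
    (hΦ : ContDiff ℝ (⊤ : ℕ∞) Φ)
    (heq : ∀ p : ℝ × ℝ,
      pdt (pdt Φ) p = (pdt (pdx Φ) p) ^ 2 / pdx (pdx Φ) p + 1 / 2 * (pdx Φ p) ^ 2)
    (hΦxx : ∀ p : ℝ × ℝ, pdx (pdx Φ) p ≠ 0)
    (hud : ∀ p : ℝ × ℝ, u p = pdt (pdx Φ) p / (2 * pdx (pdx Φ) p))
    (hvd : ∀ p : ℝ × ℝ, v p = -(pdx Φ p) / 4)
    (n : ℕ) (hn : 1 ≤ n)
    (G : (Fin (2 * n - 1) → ℝ) → ℝ) (hG : ContDiff ℝ (⊤ : ℕ∞) G)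
    (α β : ℕ → ℝ × ℝ → ℝ)
    (hα1 : ∀ p : ℝ × ℝ, α 1 p = (pdx u p) ^ 2 * ((pdx v p) ^ 2)⁻¹ - 2 * (pdx v p)⁻¹)
    (hβ1 : ∀ p : ℝ × ℝ, β 1 p = pdx u p * (pdx v p)⁻¹)
    (hαrec : ∀ k, 1 ≤ k → ∀ p : ℝ × ℝ, α (k + 1) p = (pdx v p)⁻¹ * pdx (α k) p)
    (hβrec : ∀ k, 1 ≤ k → ∀ p : ℝ × ℝ, β (k + 1) p = (pdx v p)⁻¹ * pdx (β k) p) :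
    ∀ p : ℝ × ℝ,
      pdt (fun q => pdx v q / 2 *
      G (fun i => if i.val = 0 then α 1 q
          else if i.val % 2 = 1 then α (i.val / 2 + 2) q
          else β (i.val / 2 + 1) q)) p
        = pdx (fun q => 2 * u q * ((fun q => pdx v q / 2 *
      G (fun i => if i.val = 0 then α 1 q
          else if i.val % 2 = 1 then α (i.val / 2 + 2) q
          else β (i.val / 2 + 1) q)) q)) p := by
  intro p
  obtain ⟨hu, hv, hv0, htv, htu⟩ := gurevichZybin_of_mongeAmpere hΦ heq hΦxx hud hvd
  have hw := contDiff_pdx hv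
  have hux := contDiff_pdx hu
  have htw : ∀ q, transport u (pdx v) q = 2 * pdx u q * pdx v q := fun q => by
    have h := pdx_transport hu hv q
    rw [funext htv, pdx_const] at h
    linear_combination -h
  have htux : ∀ q, transport u (pdx u) q = -2 * pdx v q + 2 * pdx u q * pdx u q := fun q => by
    have h := pdx_transport hu hu q
    rw [funext htu, pdx_mul contDiff_const hv, pdx_const] at h
    linear_combination -h
  have hβs : ContDiff ℝ ∞ (β 1) := by
    rw [funext hβ1]
    exact hux.mul (hw.inv hv0)
  have hαs : ContDiff ℝ ∞ (α 1) := by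
    rw [funext hα1]
    exact ((hux.pow 2).mul ((hw.pow 2).inv fun q => pow_ne_zero 2 (hv0 q))).sub
      (contDiff_const.mul (hw.inv hv0))
  have eβ : (fun q => β 1 q * pdx v q) = pdx u := by
    funext q
    rw [hβ1]
    field_simp [hv0 q]
  have eα : (fun q => α 1 q * pdx v q) = fun q => β 1 q * pdx u q + -2 := by
    funext q
    rw [hα1, hβ1]
    field_simp [hv0 q]
    ring
  have htβ : ∀ q, transport u (β 1) q = -2 := fun q => by
    have h := transport_mul u hβs hw q
    have e := congrFun eβ q
    rw [eβ, htux, htw] at h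
    apply mul_right_cancel₀ (hv0 q)
    linear_combination -h - 2 * pdx u q * e
  have htα : ∀ q, transport u (α 1) q = 0 := fun q => by
    have h := transport_mul u hαs hw q
    have e := congrFun eα q
    have e' := congrFun eβ q
    rw [eα, transport_add u (hβs.mul hux) contDiff_const, transport_const,
      transport_mul u hβs hux, htβ, htux, htw] at h
    apply mul_right_cancel₀ (hv0 q)
    linear_combination -h - 2 * pdx u q * e - 2 * e'
  have hα : ∀ k, ContDiff ℝ ∞ (α (k + 1)) ∧ ∀ q, transport u (α (k + 1)) q = 0 := by
    intro k
    induction k with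
    | zero => exact ⟨hαs, htα⟩
    | succ k ih =>
      exact transport_div_pdx hu hv hv0 htv ih.1 (hαrec (k + 1) (by omega)) 0 ih.2
  have hβ : ∀ k, ContDiff ℝ ∞ (β (k + 2)) ∧ ∀ q, transport u (β (k + 2)) q = 0 := by
    intro k
    induction k with
    | zero => exact transport_div_pdx hu hv hv0 htv hβs (hβrec 1 le_rfl) (-2) htβ
    | succ k ih =>
      exact transport_div_pdx hu hv hv0 htv ih.1 (hβrec (k + 2) (by omega)) 0 ih.2
  let A : ℝ × ℝ → Fin (2 * n - 1) → ℝ := fun q i =>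
    if i.val = 0 then α 1 q
    else if i.val % 2 = 1 then α (i.val / 2 + 2) q
    else β (i.val / 2 + 1) q
  have hA : ∀ i, ContDiff ℝ ∞ (fun q => A q i) ∧ ∀ q, transport u (fun q => A q i) q = 0 := by
    intro i
    simp only [A]
    by_cases h0 : i.val = 0
    · simp only [h0, if_true]
      exact hα 0
    by_cases h1 : i.val % 2 = 1
    · simp only [h0, h1, if_true, if_false]
      exact hα (i.val / 2 + 1)
    · simp only [h0, h1, if_false]
      obtain ⟨k, hk⟩ : ∃ k, i.val / 2 + 1 = k + 2 := ⟨i.val / 2 - 1, by omega⟩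
      rw [hk]
      exact hβ k
  have hGA : ContDiff ℝ ∞ (fun q => G (A q)) := hG.comp (contDiff_pi.2 fun i => (hA i).1)
  have htG := transport_comp_eq_zero u hG (fun i => (hA i).1) (fun i => (hA i).2) p
  have hw2 : ContDiff ℝ ∞ (fun q => pdx v q * (1 / 2)) := hw.mul contDiff_const
  have eF : (fun q => pdx v q / 2 * G (A q)) = fun q => pdx v q * (1 / 2) * G (A q) := by
    funext q
    ring
  change pdt (fun q => pdx v q / 2 * G (A q)) p
    = pdx (fun q => 2 * u q * ((fun q => pdx v q / 2 * G (A q)) q)) p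
  rw [eF, pdx_mul (contDiff_const.mul hu) (hw2.mul hGA), pdx_mul contDiff_const hu, pdx_const]
  have h1 := transport_mul u hw2 hGA p
  rw [htG, transport_mul u hw contDiff_const, transport_const, htw, transport] at h1
  linear_combination h1
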